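/- arXiv:1707.01013 — 6 statements merged into one kernel-verified Lean document; each statement's English description precedes it below -/
import Mathlib

section
/- Let β ∈ (1, β_T], where β_T is the unique root of x³ − x² − 2x + 1 = 0 in (1,2). If (ε_i) ∈ Ũ_β and (ε_i) is neither the constant sequence 0^∞ nor the constant sequence 1^∞, then (ε_i) is simply normal. -/
/-- A {0,1}-sequence is simply normal if the frequency of zeros tends to 1/2. -/
def simplyNormal (ε : ℕ → ℕ) : Prop :=
  Filter.Tendsto
    (fun n => (((Finset.range n).filter fun i => ε i = 0).card : ℝ) / n)
    Filter.atTop (nhds (1 / 2))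

/-- `ε` is a univoque sequence for base β: it is a {0,1}-sequence and the unique
β-expansion of the number it represents. -/
def isUnivoqueSeq (β : ℝ) (ε : ℕ → ℕ) : Prop :=
  (∀ i, ε i ≤ 1) ∧ ∀ δ : ℕ → ℕ, (∀ i, δ i ≤ 1) →
    (∑' i : ℕ, (δ i : ℝ) / β ^ (i + 1)) = (∑' i : ℕ, (ε i : ℝ) / β ^ (i + 1)) →
    δ = ε

/-- Digits driven by a bounded remainder sequence sum to the initial remainder. -/
lemma hasSum_of_remainder (β c : ℝ) (hβ : 1 < β) (g : ℕ → ℕ) (r : ℕ → ℝ)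
    (hr0 : ∀ i, 0 ≤ r i) (hrc : ∀ i, r i ≤ c) (hrec : ∀ i, r (i + 1) = β * r i - g i) :
    HasSum (fun i : ℕ => (g i : ℝ) / β ^ (i + 1)) (r 0) := by
  have hb : 0 < β := by linarith
  have hpart : ∀ n, ∑ i ∈ Finset.range n, (g i : ℝ) / β ^ (i + 1) = r 0 - r n / β ^ n := by
    intro n
    induction n with
    | zero => simp
    | succ n ih =>
      rw [Finset.sum_range_succ, ih, hrec]
      field_simp
      ring
  rw [hasSum_iff_tendsto_nat_of_nonneg (fun i => by positivity)]
  have hpow : Filter.Tendsto (fun n : ℕ => c * (1 / β) ^ n) Filter.atTop (nhds 0) := by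
    have := (tendsto_pow_atTop_nhds_zero_of_lt_one (r := 1 / β) (by positivity)
      (by rw [div_lt_one hb]; exact hβ)).const_mul c
    simpa using this
  have hz : Filter.Tendsto (fun n : ℕ => r n / β ^ n) Filter.atTop (nhds 0) := by
    refine squeeze_zero (fun n => div_nonneg (hr0 n) (by positivity)) (fun n => ?_) hpow
    rw [one_div, inv_pow, ← div_eq_mul_inv]
    exact div_le_div_of_nonneg_right (hrc n) (by positivity)
  have := hz.const_sub (r 0)
  simp only [sub_zero] at this
  exact this.congr (fun n => (hpart n).symm)

/-- Greedy remainders. -/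
noncomputable def greedyRem (β x : ℝ) : ℕ → ℝ
  | 0 => x
  | n + 1 => β * greedyRem β x n - ((if 1 ≤ β * greedyRem β x n then 1 else 0 : ℕ) : ℝ)

lemma greedyRem_mem (β c x : ℝ) (hβ : 1 < β) (hβ2 : β < 2) (hc : c * (β - 1) = 1)
    (h0 : 0 ≤ x) (hx : x ≤ c) (n : ℕ) : 0 ≤ greedyRem β x n ∧ greedyRem β x n ≤ c := by
  induction n with
  | zero => exact ⟨h0, hx⟩
  | succ n ih =>
    obtain ⟨i1, i2⟩ := ih
    simp only [greedyRem]
    split_ifs with h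
    · push_cast
      constructor
      · linarith
      · nlinarith
    · push_cast
      push Not at h
      constructor
      · nlinarith
      · nlinarith

/-- The tails of a univoque sequence. -/
lemma univoque_tail (β c : ℝ) (hβ : 1 < β) (hβ2 : β < 2) (hc : c * (β - 1) = 1)
    (ε : ℕ → ℕ) (hε : isUnivoqueSeq β ε) :
    ∃ t : ℕ → ℝ, (∀ n, t (n + 1) = β * t n - ε n) ∧
      (∀ n, ε n = 0 → t (n + 1) < 1) ∧ (∀ n, ε n = 1 → c - 1 < t (n + 1)) := by
  obtain ⟨hε1, huniq⟩ := hε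
  have hb : 0 < β := by linarith
  have hgeo : HasSum (fun i : ℕ => ((1 : ℕ) : ℝ) / β ^ (i + 1)) c := by
    refine hasSum_of_remainder β c hβ (fun _ => 1) (fun _ => c) (fun _ => ?_) (fun _ => le_rfl)
      (fun _ => ?_)
    · by_contra h
      push Not at h
      nlinarith
    · push_cast
      linarith
  have hle : ∀ n i, (ε (n + i) : ℝ) / β ^ (i + 1) ≤ ((1 : ℕ) : ℝ) / β ^ (i + 1) := by
    intro n i
    have : (ε (n + i) : ℝ) ≤ ((1 : ℕ) : ℝ) := by exact_mod_cast hε1 _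
    exact div_le_div_of_nonneg_right this (by positivity)
  have hsum : ∀ n, Summable (fun i : ℕ => (ε (n + i) : ℝ) / β ^ (i + 1)) := fun n =>
    Summable.of_nonneg_of_le (fun i => by positivity) (hle n) hgeo.summable
  let t : ℕ → ℝ := fun n => ∑' i : ℕ, (ε (n + i) : ℝ) / β ^ (i + 1)
  have ht0 : ∀ n, 0 ≤ t n := fun n => tsum_nonneg (fun i => by positivity)
  have htc : ∀ n, t n ≤ c := fun n => by
    rw [← hgeo.tsum_eq]
    exact (hsum n).tsum_le_tsum (hle n) hgeo.summable
  have hrec : ∀ n, t (n + 1) = β * t n - ε n := by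
    intro n
    have h1 : t n = (ε n : ℝ) / β + ∑' i : ℕ, (ε (n + (i + 1)) : ℝ) / β ^ (i + 1 + 1) := by
      have := (hsum n).tsum_eq_zero_add
      simpa using this
    have h2 : ∑' i : ℕ, (ε (n + (i + 1)) : ℝ) / β ^ (i + 1 + 1) = t (n + 1) / β := by
      rw [← tsum_div_const]
      refine tsum_congr (fun i => ?_)
      rw [show n + (i + 1) = n + 1 + i by ring, pow_succ β (i + 1), div_div]
    rw [h1, h2]
    field_simp
    ring
  have key : ∀ (n e : ℕ) (y : ℝ), e ≤ 1 → 0 ≤ y → y ≤ c → (e : ℝ) + y = ε n + t (n + 1) →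
      e = ε n := by
    intro n e y he hy0 hyc hey
    let g : ℕ → ℕ := fun i => if 1 ≤ β * greedyRem β y i then 1 else 0
    let δ : ℕ → ℕ := fun i => if i < n then ε i else if i = n then e else g (i - n - 1)
    let r : ℕ → ℝ := fun i => if i ≤ n then t i else greedyRem β y (i - n - 1)
    have hr : ∀ i, 0 ≤ r i ∧ r i ≤ c := by
      intro i
      simp only [r]
      split_ifs
      · exact ⟨ht0 i, htc i⟩
      · exact greedyRem_mem β c y hβ hβ2 hc hy0 hyc _
    have hs := hasSum_of_remainder β c hβ δ r (fun i => (hr i).1) (fun i => (hr i).2) (by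
      intro i
      rcases lt_trichotomy i n with h | h | h
      · have h' : i + 1 ≤ n := h
        simp only [r, δ, if_pos h, if_pos h', if_pos h.le]
        exact hrec i
      · subst h
        simp only [r, δ, lt_irrefl, if_false, if_true, le_refl]
        rw [if_neg (by omega), show i + 1 - i - 1 = 0 by omega]
        have := hrec i
        simp only [greedyRem]
        linarith
      · simp only [r, δ]
        rw [if_neg (by omega), if_neg (by omega), if_neg (by omega), if_neg (by omega),
          show i + 1 - n - 1 = (i - n - 1) + 1 by omega]
        simp only [greedyRem, g])
    have hδ : δ = ε := by
      apply huniq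
      · intro i
        simp only [δ, g]
        split_ifs <;> first | exact hε1 _ | omega
      · rw [hs.tsum_eq]
        simp [r, t]
    have := congrFun hδ n
    simpa [δ] using this
  refine ⟨t, hrec, ?_, ?_⟩
  · intro n hn
    by_contra h
    push Not at h
    have := key n 1 (t (n + 1) - 1) le_rfl (by linarith) (by linarith [htc (n + 1)])
      (by rw [hn]; push_cast; ring)
    omega
  · intro n hn
    by_contra h
    push Not at h
    have := key n 0 (t (n + 1) + 1) (by omega) (by linarith [ht0 (n + 1)]) (by linarith)
      (by rw [hn]; push_cast; ring)
    omega

/-- Bounded discrepancy implies simple normality. -/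
lemma simplyNormal_of_bounded (ε : ℕ → ℕ) (hε1 : ∀ i, ε i ≤ 1) (K : ℝ)
    (hK : ∀ n, |∑ i ∈ Finset.range n, (2 * (ε i : ℝ) - 1)| ≤ K) : simplyNormal ε := by
  have hcount : ∀ n, ∑ i ∈ Finset.range n, (2 * (ε i : ℝ) - 1)
      = n - 2 * (((Finset.range n).filter fun i => ε i = 0).card : ℝ) := by
    intro n
    rw [Finset.card_filter]
    push_cast
    rw [Finset.mul_sum]
    have : (n : ℝ) = ∑ i ∈ Finset.range n, (1 : ℝ) := by simp
    rw [this, ← Finset.sum_sub_distrib]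
    refine Finset.sum_congr rfl (fun i _ => ?_)
    have := hε1 i
    interval_cases h : ε i <;> norm_num
  unfold simplyNormal
  rw [tendsto_iff_dist_tendsto_zero]
  have hlim : Filter.Tendsto (fun n : ℕ => (K / 2) / (n : ℝ)) Filter.atTop (nhds 0) :=
    tendsto_const_div_atTop_nhds_zero_nat _
  refine squeeze_zero' (Filter.Eventually.of_forall fun n => dist_nonneg) ?_ hlim
  filter_upwards [Filter.eventually_gt_atTop 0] with n hn
  have hn' : (0 : ℝ) < n := by exact_mod_cast hn
  have h := hK n
  rw [hcount] at h
  rw [Real.dist_eq, le_div_iff₀ hn', ← abs_of_pos hn', ← abs_mul, abs_of_pos hn']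
  have : ((((Finset.range n).filter fun i => ε i = 0).card : ℝ) / n - 1 / 2) * n
      = -((n - 2 * (((Finset.range n).filter fun i => ε i = 0).card : ℝ)) / 2) := by
    field_simp
    ring
  rw [this, abs_neg, abs_div, abs_two]
  linarith

set_option maxHeartbeats 1000000 in
theorem univoque_seq_simply_normal_below_betaT
    (βT : ℝ) (hβT : βT ∈ Set.Ioo (1 : ℝ) 2)
    (hroot : βT ^ 3 - βT ^ 2 - 2 * βT + 1 = 0)
    (β : ℝ) (hβ : β ∈ Set.Ioc (1 : ℝ) βT)
    (ε : ℕ → ℕ) (hε : isUnivoqueSeq β ε)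
    (h0 : ε ≠ fun _ => 0) (h1 : ε ≠ fun _ => 1) :
    simplyNormal ε := by
  obtain ⟨hT1, hT2⟩ := hβT
  obtain ⟨hb1, hbT⟩ := hβ
  have hb2 : β < 2 := by linarith
  have hε1 := hε.1
  have hcub : β ^ 3 - β ^ 2 - 2 * β + 1 ≤ 0 := by
    have hT : 0 < βT ^ 2 - 2 := by
      by_contra h
      push Not at h
      nlinarith
    have e : β ^ 3 - β ^ 2 - 2 * β + 1
        = (β - βT) * (β ^ 2 + (βT - 1) * β + (βT ^ 2 - βT - 2)) := by
      linear_combination hroot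
    rw [e]
    apply mul_nonpos_of_nonpos_of_nonneg (by linarith)
    nlinarith
  obtain ⟨c, hc⟩ : ∃ c : ℝ, c * (β - 1) = 1 := ⟨(β - 1)⁻¹, inv_mul_cancel₀ (by linarith)⟩
  obtain ⟨p, hp⟩ : ∃ p : ℝ, p * (β + 1) = 1 := ⟨(β + 1)⁻¹, inv_mul_cancel₀ (by linarith)⟩
  obtain ⟨t, hrec, ht0, ht1⟩ := univoque_tail β c hb1 hb2 hc ε hε
  obtain ⟨d, hd⟩ : ∃ d : ℝ, d = 2 - c := ⟨_, rfl⟩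
  obtain ⟨v, hv⟩ : ∃ v : ℕ → ℝ, ∀ n, v n = 2 * t n - c := ⟨fun n => 2 * t n - c, fun _ => rfl⟩
  have hdig : ∀ n, ε n = 0 ∨ ε n = 1 := fun n => by have := hε1 n; omega
  have v0 : ∀ n, ε n = 0 → v (n + 1) = β * v n + 1 ∧ v (n + 1) < d := by
    intro n hn
    have h := hrec n
    rw [hn] at h
    push_cast at h
    refine ⟨?_, ?_⟩
    · rw [hv, hv, h]; linarith
    · rw [hv, hd]; linarith [ht0 n hn]
  have v1 : ∀ n, ε n = 1 → v (n + 1) = β * v n - 1 ∧ -d < v (n + 1) := by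
    intro n hn
    have h := hrec n
    rw [hn] at h
    push_cast at h
    refine ⟨?_, ?_⟩
    · rw [hv, hv, h]; linarith
    · rw [hv, hd]; linarith [ht1 n hn]
  have hdd : β * d - 1 ≤ d := by
    rw [hd]; nlinarith
  -- entry into the trap
  have hentry : ∃ N, |v N| ≤ d := by
    have : ∃ n, ε n ≠ ε (n + 1) := by
      by_contra h
      push Not at h
      have hconst : ∀ n, ε n = ε 0 := by
        intro n
        induction n with
        | zero => rfl
        | succ n ih => rw [← h n, ih]
      rcases hdig 0 with h' | h'
      · exact h0 (funext fun n => by rw [hconst n, h'])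
      · exact h1 (funext fun n => by rw [hconst n, h'])
    obtain ⟨n, hn⟩ := this
    refine ⟨n + 1 + 1, ?_⟩
    rw [abs_le]
    rcases hdig n with a | a <;> rcases hdig (n + 1) with b | b
    · omega
    · obtain ⟨_, a2⟩ := v0 n a
      obtain ⟨b1, b2⟩ := v1 (n + 1) b
      constructor <;> nlinarith
    · obtain ⟨_, a2⟩ := v1 n a
      obtain ⟨b1, b2⟩ := v0 (n + 1) b
      constructor <;> nlinarith
    · omega
  obtain ⟨N, hN⟩ := hentry
  have htrap : ∀ k, |v (N + k)| ≤ d := by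
    intro k
    induction k with
    | zero => exact hN
    | succ k ih =>
      rw [abs_le] at ih ⊢
      obtain ⟨i1, i2⟩ := ih
      rw [← add_assoc]
      rcases hdig (N + k) with a | a
      · obtain ⟨a1, a2⟩ := v0 _ a
        constructor <;> nlinarith
      · obtain ⟨a1, a2⟩ := v1 _ a
        constructor <;> nlinarith
  have hp0 : 0 < p := by
    by_contra h
    push Not at h
    nlinarith
  have hkey : β * (β * d - 1) - 1 ≤ -p := by
    have hpos : 0 < (β - 1) * (β + 1) := by nlinarith
    have e : (β * (β * d - 1) - 1 + p) * ((β - 1) * (β + 1))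
        = 2 * β * (β ^ 3 - β ^ 2 - 2 * β + 1) := by
      rw [hd]
      linear_combination (-(β ^ 2 * (β + 1))) * hc + (β - 1) * hp
    have : (β * (β * d - 1) - 1 + p) * ((β - 1) * (β + 1)) ≤ 0 := by
      rw [e]
      exact mul_nonpos_of_nonneg_of_nonpos (by linarith) hcub
    by_contra h
    push Not at h
    nlinarith
  obtain ⟨q, hq⟩ : ∃ q, q = max p (β * d - 1) := ⟨_, rfl⟩
  have hqp : p ≤ q := hq ▸ le_max_left _ _
  have hqd : β * d - 1 ≤ q := hq ▸ le_max_right _ _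
  have hqk : β * q - 1 ≤ -p := by
    rcases max_choice p (β * d - 1) with h | h
    · rw [hq, h]; linarith
    · rw [hq, h]; exact hkey
  have hforb : d < β * p + 1 := by
    have e : (β * p + 1 - d) * ((β - 1) * (β + 1)) = 2 := by
      rw [hd]
      linear_combination (β + 1) * hc + β * (β - 1) * hp
    by_contra h
    push Not at h
    nlinarith [mul_pos (sub_pos.2 hb1) (by linarith : 0 < β + 1)]
  -- the walk
  let E : ℕ → ℝ := fun n => ∑ i ∈ Finset.range n, (2 * (ε i : ℝ) - 1)
  have hE0 : ∀ n, ε n = 0 → E (n + 1) = E n - 1 := by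
    intro n hn
    simp only [E, Finset.sum_range_succ, hn]
    push_cast; ring
  have hE1 : ∀ n, ε n = 1 → E (n + 1) = E n + 1 := by
    intro n hn
    simp only [E, Finset.sum_range_succ, hn]
    push_cast; ring
  have hinv : ∃ a : ℝ, ∀ k, (E (N + k) = a + 1 ∧ v (N + k) ≤ -p) ∨
      (E (N + k) = a - 1 ∧ p ≤ v (N + k)) ∨
      (E (N + k) = a ∧ -q ≤ v (N + k) ∧ v (N + k) ≤ q) := by
    have hstep : ∀ a : ℝ, ∀ n, |v n| ≤ d → ((E n = a + 1 ∧ v n ≤ -p) ∨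
      (E n = a - 1 ∧ p ≤ v n) ∨ (E n = a ∧ -q ≤ v n ∧ v n ≤ q)) →
      ((E (n + 1) = a + 1 ∧ v (n + 1) ≤ -p) ∨
      (E (n + 1) = a - 1 ∧ p ≤ v (n + 1)) ∨
      (E (n + 1) = a ∧ -q ≤ v (n + 1) ∧ v (n + 1) ≤ q)) := by
      intro a n hvn h
      rw [abs_le] at hvn
      obtain ⟨i1, i2⟩ := hvn
      have hm : ∀ x y : ℝ, x ≤ y → β * x ≤ β * y := fun x y hxy =>
        mul_le_mul_of_nonneg_left hxy (by linarith)
      have m1 := hm _ _ i1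
      have m2 := hm _ _ i2
      rcases h with ⟨he, h⟩ | ⟨he, h⟩ | ⟨he, h, h'⟩ <;> rcases hdig n with b | b
      · obtain ⟨b1, b2⟩ := v0 n b
        refine Or.inr (Or.inr ⟨by rw [hE0 n b]; linarith, ?_, ?_⟩) <;> linarith [hm _ _ h]
      · obtain ⟨b1, b2⟩ := v1 n b
        exfalso
        linarith [hm _ _ h]
      · obtain ⟨b1, b2⟩ := v0 n b
        exfalso
        linarith [hm _ _ h]
      · obtain ⟨b1, b2⟩ := v1 n b
        refine Or.inr (Or.inr ⟨by rw [hE1 n b]; linarith, ?_, ?_⟩) <;> linarith [hm _ _ h]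
      · obtain ⟨b1, b2⟩ := v0 n b
        refine Or.inr (Or.inl ⟨by rw [hE0 n b]; linarith, ?_⟩)
        linarith [hm _ _ h]
      · obtain ⟨b1, b2⟩ := v1 n b
        refine Or.inl ⟨by rw [hE1 n b]; linarith, ?_⟩
        linarith [hm _ _ h']
    have hstart : ∃ a : ℝ, (E N = a + 1 ∧ v N ≤ -p) ∨
        (E N = a - 1 ∧ p ≤ v N) ∨ (E N = a ∧ -q ≤ v N ∧ v N ≤ q) := by
      by_cases c1 : v N ≤ -p
      · exact ⟨E N - 1, Or.inl ⟨by ring, c1⟩⟩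
      · by_cases c2 : p ≤ v N
        · exact ⟨E N + 1, Or.inr (Or.inl ⟨by ring, c2⟩)⟩
        · exact ⟨E N, Or.inr (Or.inr ⟨rfl, by linarith, by linarith⟩)⟩
    obtain ⟨a, ha⟩ := hstart
    refine ⟨a, fun k => ?_⟩
    induction k with
    | zero => exact ha
    | succ k ih => exact hstep a (N + k) (htrap k) ih
  obtain ⟨a, ha⟩ := hinv
  have hEn : ∀ n, |E n| ≤ n := by
    intro n
    induction n with
    | zero => simp [E]
    | succ n ih =>
      rw [abs_le] at ih ⊢
      push_cast
      rcases hdig n with b | b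
      · rw [hE0 n b]; constructor <;> linarith
      · rw [hE1 n b]; constructor <;> linarith
  refine simplyNormal_of_bounded ε hε1 (|a| + 1 + N) (fun n => ?_)
  change |E n| ≤ _
  have hNn : (0 : ℝ) ≤ N := Nat.cast_nonneg _
  rcases le_total n N with h | h
  · have h' : (n : ℝ) ≤ N := by exact_mod_cast h
    linarith [hEn n, abs_nonneg a]
  · obtain ⟨k, rfl⟩ := Nat.exists_eq_add_of_le h
    have l1 := le_abs_self a
    have l2 := neg_abs_le a
    rw [abs_le]
    rcases ha k with ⟨he, _⟩ | ⟨he, _⟩ | ⟨he, _⟩ <;> rw [he] <;> constructor <;> linarith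
end

section
/- For every β ∈ (β_T, 2), where β_T is the unique root of x³ − x² − 2x + 1 = 0 in (1,2), there exists j ∈ ℕ such that the periodic sequence (1(10)^{j+1})^∞ belongs to Ũ_β. In particular, Ũ_β contains a periodic sequence whose period 2j + 3 is odd. -/
/-- The periodic sequence `(1(10)^{j+1})^∞` of (odd) period `2j+3`:
within each period, position 0 carries digit 1, and the following `2(j+1)`
positions alternate `1,0,1,0,…`. -/
def oddPeriodicSeq (j : ℕ) : ℕ → ℕ := fun i =>
  if i % (2 * j + 3) = 0 ∨ (i % (2 * j + 3)) % 2 = 1 then 1 else 0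

open Filter Topology in
theorem tsum_of_rec (β : ℝ) (hβ : 1 < β) (ε : ℕ → ℕ) (hε : ∀ i, ε i ≤ 1) (W : ℕ → ℝ) (M : ℝ)
    (hM : ∀ n, |W n| ≤ M) (hrec : ∀ n, β * W n = ε n + W (n+1)) :
    (∑' i : ℕ, (ε i : ℝ) / β ^ (i + 1)) = W 0 := by
  have hβ0 : 0 < β := by linarith
  have key : ∀ n, ∑ i ∈ Finset.range n, (ε i : ℝ) / β ^ (i + 1) = W 0 - W n * (β⁻¹) ^ n := by
    intro n
    induction n with
    | zero => simp
    | succ n ih =>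
      rw [Finset.sum_range_succ, ih]
      have h2 : W (n+1) = β * W n - ε n := by linarith [hrec n]
      rw [h2, inv_pow, inv_pow]
      field_simp
      ring
  have hlim : Tendsto (fun n => W n * (β⁻¹) ^ n) atTop (𝓝 0) := by
    have h1 : Tendsto (fun n : ℕ => M * (β⁻¹) ^ n) atTop (𝓝 0) := by
      have := (tendsto_pow_atTop_nhds_zero_of_lt_one (r := β⁻¹) (by positivity)
        (inv_lt_one_of_one_lt₀ hβ)).const_mul M
      simpa using this
    refine squeeze_zero_norm (fun n => ?_) h1
    rw [norm_mul, Real.norm_eq_abs, Real.norm_eq_abs, abs_of_pos (by positivity : 0 < (β⁻¹)^n)]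
    exact mul_le_mul_of_nonneg_right (hM n) (by positivity)
  have hs : HasSum (fun i : ℕ => (ε i : ℝ) / β ^ (i + 1)) (W 0) := by
    rw [hasSum_iff_tendsto_nat_of_nonneg (fun i => by positivity)]
    simp_rw [key]
    simpa using hlim.const_sub (W 0)
  exact hs.tsum_eq

theorem geo_hasSum (β : ℝ) (hβ : 1 < β) :
    HasSum (fun i : ℕ => (1 : ℝ) / β ^ (i + 1)) (1 / (β - 1)) := by
  have h := (hasSum_geometric_of_lt_one (r := β⁻¹) (by positivity)
        (inv_lt_one_of_one_lt₀ hβ)).mul_left β⁻¹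
  have hβ0 : 0 < β := by linarith
  have hβ1 : β - 1 ≠ 0 := by linarith
  have e1 : (fun i : ℕ => (1 : ℝ) / β ^ (i + 1)) = fun i => β⁻¹ * β⁻¹ ^ i := by
    funext i
    rw [inv_pow, pow_succ]; field_simp
  have e2 : 1 / (β - 1) = β⁻¹ * (1 - β⁻¹)⁻¹ := by
    have : 1 - β⁻¹ = (β - 1) / β := by field_simp
    rw [this]; field_simp
  rw [e1, e2]
  exact h

theorem univ_of_rec (β : ℝ) (hβ : 1 < β) (ε : ℕ → ℕ) (hε : ∀ i, ε i ≤ 1) (W : ℕ → ℝ) (M : ℝ)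
    (hM : ∀ n, |W n| ≤ M) (hrec : ∀ n, β * W n = ε n + W (n+1))
    (h0 : ∀ n, ε n = 0 → W (n+1) < 1) (h1 : ∀ n, ε n = 1 → 1 / (β - 1) < 1 + W (n+1)) :
    isUnivoqueSeq β ε := by
  refine ⟨hε, fun δ hδ heq => ?_⟩
  rw [tsum_of_rec β hβ ε hε W M hM hrec] at heq
  have hβ0 : 0 < β := by linarith
  have hle : ∀ n i, (δ (n+i) : ℝ) / β ^ (i+1) ≤ 1 / β ^ (i+1) := fun n i => by
    have : (δ (n+i) : ℝ) ≤ 1 := by exact_mod_cast hδ _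
    gcongr
  have hsum : ∀ n, Summable (fun i : ℕ => (δ (n+i) : ℝ) / β ^ (i+1)) := fun n =>
    Summable.of_nonneg_of_le (fun i => by positivity) (hle n) (geo_hasSum β hβ).summable
  set D : ℕ → ℝ := fun n => ∑' i : ℕ, (δ (n+i) : ℝ) / β ^ (i+1) with hD
  have hDnn : ∀ n, 0 ≤ D n := fun n => tsum_nonneg (fun i => by positivity)
  have hDle : ∀ n, D n ≤ 1 / (β - 1) := fun n => by
    rw [← (geo_hasSum β hβ).tsum_eq]
    exact (hsum n).tsum_le_tsum (hle n) (geo_hasSum β hβ).summable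
  have hDrec : ∀ n, β * D n = δ n + D (n+1) := fun n => by
    simp only [hD]
    rw [(hsum n).tsum_eq_zero_add, mul_add, ← tsum_mul_left]
    congr 1
    · simp; field_simp
    · congr 1
      funext i
      rw [show n + (i+1) = n+1+i by ring, pow_succ β (i+1)]
      field_simp
  have hstep : ∀ n, D n = W n → δ n = ε n ∧ D (n+1) = W (n+1) := by
    intro n hn
    have e1 := hDrec n
    have e2 := hrec n
    rw [hn, e2] at e1
    have hd := hδ n
    have he := hε n
    have : δ n = ε n := by
      rcases Nat.le_one_iff_eq_zero_or_eq_one.mp hd with a | a <;>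
      rcases Nat.le_one_iff_eq_zero_or_eq_one.mp he with b | b <;> rw [a, b] <;>
        rw [a, b] at e1
      · exfalso
        have := h1 n b
        have := hDle (n+1)
        push_cast at e1
        linarith
      · exfalso
        have := h0 n b
        have := hDnn (n+1)
        push_cast at e1
        linarith
    refine ⟨this, ?_⟩
    rw [this] at e1
    linarith
  have hall : ∀ n, D n = W n := by
    intro n
    induction n with
    | zero => simpa [hD] using heq
    | succ n ih => exact (hstep n ih).2
  funext n
  exact (hstep n (hall n)).1

open Filter Topology in
theorem exists_j (β : ℝ) (hβ : 1 < β) (a A : ℝ) (h : a + A < 1) :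
    ∃ j : ℕ, a + A / (1 - (β⁻¹) ^ (2 * j + 3)) < 1 := by
  have h1 : Tendsto (fun n : ℕ => (β⁻¹) ^ n) atTop (𝓝 0) :=
    tendsto_pow_atTop_nhds_zero_of_lt_one (r := β⁻¹) (by positivity) (inv_lt_one_of_one_lt₀ hβ)
  have h2 : Tendsto (fun j : ℕ => 2 * j + 3) atTop atTop :=
    tendsto_atTop_mono (fun j => by simp; omega) tendsto_id
  have h3 := ((h1.comp h2).const_sub 1)
  have h4 := ((tendsto_const_nhds (x := A)).div h3 (by norm_num)).const_add a
  simp only [sub_zero, div_one] at h4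
  exact (h4.eventually_lt_const h).exists

theorem univoque_contains_odd_periodic_above_betaT
    (βT : ℝ) (hβT : βT ∈ Set.Ioo (1 : ℝ) 2)
    (hroot : βT ^ 3 - βT ^ 2 - 2 * βT + 1 = 0)
    (β : ℝ) (hβ : β ∈ Set.Ioo βT 2) :
    ∃ j : ℕ, isUnivoqueSeq β (oddPeriodicSeq j) ∧
      (∀ i, oddPeriodicSeq j (i + (2 * j + 3)) = oddPeriodicSeq j i) ∧
      Odd (2 * j + 3) := by
  obtain ⟨hT1, hT2⟩ := hβT
  obtain ⟨hb, hb2⟩ := hβ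
  have hβ1 : 1 < β := by linarith
  have hβ0 : 0 < β := by linarith
  have hTg : 0 < βT ^ 2 - βT - 1 := by
    have : 0 < βT * (βT ^ 2 - βT - 1) := by nlinarith
    exact (mul_pos_iff_of_pos_left (by linarith)).mp this
  have hg : 0 < β ^ 2 - β - 1 := by nlinarith
  have hp : 0 < β ^ 3 - β ^ 2 - 2 * β + 1 := by
    have h1 : 0 < β * βT + βT ^ 2 - βT - 1 := by nlinarith
    have h2 := mul_pos (sub_pos.mpr hb) (add_pos hg h1)
    nlinarith
  have hsq : 0 < β ^ 2 - 1 := by nlinarith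
  set c : ℝ := 1 / (β ^ 2 - 1) with hc
  have hc0 : 0 < c := by positivity
  have hceq : β ^ 2 * c = 1 + c := by rw [hc]; field_simp; ring
  set A : ℝ := 1 / (β * (β + 1)) with hA
  have hA0 : 0 < A := by positivity
  have hAeq : β * A + β ^ 2 * c = 1 + β * c := by
    have : β * A = 1 / (β + 1) := by rw [hA]; field_simp
    rw [this, hc, show β ^ 2 - 1 = (β + 1) * (β - 1) by ring]
    have : β - 1 ≠ 0 := by linarith
    field_simp; ring
  have hlt : β * c + A < 1 := by
    have e : 1 - (β * c + A) = (β ^ 3 - β ^ 2 - 2 * β + 1) / (β * (β ^ 2 - 1)) := by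
      rw [hA, hc, show β ^ 2 - 1 = (β + 1) * (β - 1) by ring]
      have : β - 1 ≠ 0 := by linarith
      field_simp; ring
    have : 0 < 1 - (β * c + A) := by rw [e]; positivity
    linarith
  have hgap : 1 / (β - 1) < 1 + c := by
    rw [← hceq, hc, div_lt_iff₀ (by linarith), show β ^ 2 - 1 = (β + 1) * (β - 1) by ring]
    have : β - 1 ≠ 0 := by linarith
    have e : β ^ 2 * (1 / ((β + 1) * (β - 1))) * (β - 1) = β ^ 2 / (β + 1) := by
      field_simp
    rw [e, lt_div_iff₀ (by linarith)]; linarith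
  obtain ⟨j, hj⟩ := exists_j β hβ1 (β * c) A hlt
  refine ⟨j, ?_, fun i => by simp [oddPeriodicSeq], ⟨j + 1, by ring⟩⟩
  have hq0 : 0 < β⁻¹ := by positivity
  have hq1 : β⁻¹ < 1 := inv_lt_one_of_one_lt₀ hβ1
  have hqN : (β⁻¹) ^ (2 * j + 3) < 1 := pow_lt_one₀ hq0.le hq1 (by omega)
  set d : ℝ := A / (1 - (β⁻¹) ^ (2 * j + 3)) with hd
  have hd0 : 0 < d := div_pos hA0 (by linarith)
  have hdeq : d = A + d * (β⁻¹) ^ (2 * j + 3) := by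
    have : d * (1 - (β⁻¹) ^ (2 * j + 3)) = A := div_mul_cancel₀ _ (by linarith)
    linarith
  -- V on residues, including the endpoint `N`
  let V : ℕ → ℝ := fun r => (if r % 2 = 1 then β * c else c) + d * (β⁻¹) ^ (2 * j + 3 - r)
  let W : ℕ → ℝ := fun n => if n % (2 * j + 3) = 0 then β * c + d else V (n % (2 * j + 3))
  have hVN : V (2 * j + 3) = β * c + d := by
    simp only [V]
    rw [if_pos (by omega)]; simp
  have hpow : ∀ k, (β⁻¹) ^ k ≤ 1 := fun k => pow_le_one₀ hq0.le hq1.le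
  have hcc : c ≤ β * c := by nlinarith
  have hVle : ∀ r, V r ≤ β * c + d := fun r => by
    have := mul_le_mul_of_nonneg_left (hpow (2 * j + 3 - r)) hd0.le
    simp only [V]; split_ifs <;> linarith
  have hVge : ∀ r, c ≤ V r := fun r => by
    have : 0 < d * (β⁻¹) ^ (2 * j + 3 - r) := by positivity
    simp only [V]; split_ifs <;> linarith
  have hWle : ∀ n, W n ≤ β * c + d := fun n => by
    simp only [W]; split_ifs
    · exact le_rfl
    · exact hVle _
  have hWge : ∀ n, c ≤ W n := fun n => by
    simp only [W]; split_ifs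
    · linarith
    · exact hVge _
  have hWsucc : ∀ n, W (n + 1) = V (n % (2 * j + 3) + 1) := by
    intro n
    have hr : n % (2 * j + 3) < 2 * j + 3 := Nat.mod_lt _ (by omega)
    by_cases h : n % (2 * j + 3) + 1 = 2 * j + 3
    · have : (n + 1) % (2 * j + 3) = 0 := by
        rw [Nat.add_mod, Nat.mod_eq_of_lt (show 1 < 2 * j + 3 by omega), h, Nat.mod_self]
      simp only [W]
      rw [if_pos this, h, hVN]
    · have : (n + 1) % (2 * j + 3) = n % (2 * j + 3) + 1 := by
        rw [Nat.add_mod, Nat.mod_eq_of_lt (show 1 < 2 * j + 3 by omega), Nat.mod_eq_of_lt (by omega)]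
      simp only [W]
      rw [this, if_neg (by omega)]
  refine univ_of_rec β hβ1 _ (fun i => ?_) W (β * c + d) (fun n => ?_) (fun n => ?_)
    (fun n _ => ?_) (fun n _ => ?_)
  · simp only [oddPeriodicSeq]; split_ifs <;> omega
  · rw [abs_of_pos (by linarith [hWge n])]; exact hWle n
  · rw [hWsucc]
    have hr : n % (2 * j + 3) < 2 * j + 3 := Nat.mod_lt _ (by omega)
    simp only [W, oddPeriodicSeq]
    generalize n % (2 * j + 3) = r at hr
    by_cases h0 : r = 0
    · subst h0
      simp only [V]
      rw [if_pos trivial, if_pos (Or.inl trivial), if_pos trivial]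
      have : β * (β⁻¹) ^ (2 * j + 3) = (β⁻¹) ^ (2 * j + 3 - (0 + 1)) := by
        rw [show 2 * j + 3 - (0 + 1) = 2 * j + 2 by omega, pow_succ]
        field_simp
      rw [← this]
      push_cast
      linear_combination β * hdeq + hAeq
    · have hpw : β * (β⁻¹) ^ (2 * j + 3 - r) = (β⁻¹) ^ (2 * j + 3 - (r + 1)) := by
        obtain ⟨k, hk⟩ : ∃ k, 2 * j + 3 - r = k + 1 := ⟨2 * j + 3 - r - 1, by omega⟩
        rw [show 2 * j + 3 - (r + 1) = k by omega, hk, pow_succ]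
        field_simp
      simp only [V]
      rw [if_neg h0, ← hpw]
      by_cases h1 : r % 2 = 1
      · rw [if_pos h1, if_pos (Or.inr h1), if_neg (by omega)]
        push_cast
        linear_combination hceq
      · rw [if_neg h1, if_neg (by tauto), if_pos (by omega)]
        push_cast
        ring
  · exact lt_of_le_of_lt (hWle _) hj
  · linarith [hWge (n + 1)]
end

section
/- Let β ∈ (1,2] and let p, q ∈ [(1+√5)/2, β) with p < q. Then π_β(0α(p)) < π_β(0α(q)), where α(p) and α(q) are the quasi-greedy p-expansion and q-expansion of 1 respectively, and 0α(r) denotes the sequence consisting of a 0 followed by α(r). In other words, the map Φ_β : [(1+√5)/2, β) → [1/(β²−1), 1/β), q ↦ π_β(0α(q)), is strictly increasing. -/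
/-- Strict lexicographic order on sequences: `a ≺ b`. -/
def lexLt (a b : ℕ → ℕ) : Prop := ∃ n, (∀ i < n, a i = b i) ∧ a n < b n

/-- Lexicographic order `a ≼ b`. -/
def lexLe (a b : ℕ → ℕ) : Prop := lexLt a b ∨ a = b

/-- A sequence does not end with `0^∞`. -/
def notEndZero (γ : ℕ → ℕ) : Prop := ∀ n, ∃ m, n ≤ m ∧ γ m ≠ 0

/-- `γ` is the quasi-greedy β-expansion of 1. -/
def isQuasiGreedy (β : ℝ) (γ : ℕ → ℕ) : Prop :=
  (∀ i, γ i ≤ 1) ∧ notEndZero γ ∧ (∑' i : ℕ, (γ i : ℝ) / β ^ (i + 1)) = 1 ∧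
  ∀ δ : ℕ → ℕ, (∀ i, δ i ≤ 1) → notEndZero δ →
    (∑' i : ℕ, (δ i : ℝ) / β ^ (i + 1)) = 1 → lexLe δ γ

/-- `π_β(0γ)`: the value in base `β` of the sequence `0` followed by `γ`. -/
noncomputable def piZero (β : ℝ) (γ : ℕ → ℕ) : ℝ :=
  ∑' i : ℕ, (γ i : ℝ) / β ^ (i + 2)

noncomputable def tl (x : ℝ) (a : ℕ → ℕ) (n : ℕ) : ℝ := ∑' i : ℕ, (a (n + i) : ℝ) / x ^ (i + 1)

lemma geo_summable (x : ℝ) (hx : 1 < x) : Summable (fun i : ℕ => (1 : ℝ) / x ^ (i + 1)) := by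
  have h := (summable_geometric_of_lt_one (r := x⁻¹) (by positivity) (inv_lt_one_of_one_lt₀ hx))
  have h2 := (summable_nat_add_iff 1).2 h
  refine h2.congr fun i => ?_
  simp

lemma term_le (x : ℝ) (hx : 1 < x) (a : ℕ → ℕ) (ha : ∀ i, a i ≤ 1) (n i : ℕ) :
    (a (n + i) : ℝ) / x ^ (i + 1) ≤ 1 / x ^ (i + 1) := by
  have : (a (n + i) : ℝ) ≤ 1 := by exact_mod_cast ha _
  have h0 : 0 < x := by linarith
  gcongr

lemma tl_summable (x : ℝ) (hx : 1 < x) (a : ℕ → ℕ) (ha : ∀ i, a i ≤ 1) (n : ℕ) :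
    Summable (fun i : ℕ => (a (n + i) : ℝ) / x ^ (i + 1)) :=
  Summable.of_nonneg_of_le (fun i => by have : 0 < x := by linarith
                                        positivity)
    (term_le x hx a ha n) (geo_summable x hx)

lemma tl_nonneg (x : ℝ) (hx : 1 < x) (a : ℕ → ℕ) (n : ℕ) : 0 ≤ tl x a n :=
  tsum_nonneg fun i => by
    have : 0 < x := by linarith
    positivity

lemma tl_le (x : ℝ) (hx : 1 < x) (a : ℕ → ℕ) (ha : ∀ i, a i ≤ 1) (n : ℕ) :
    tl x a n ≤ ∑' i : ℕ, (1 : ℝ) / x ^ (i + 1) :=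
  (tl_summable x hx a ha n).tsum_le_tsum (term_le x hx a ha n) (geo_summable x hx)

lemma tl_succ (x : ℝ) (hx : 1 < x) (a : ℕ → ℕ) (ha : ∀ i, a i ≤ 1) (n : ℕ) :
    tl x a (n + 1) = x * tl x a n - a n := by
  have h0 : x ≠ 0 := by linarith
  unfold tl
  rw [(tl_summable x hx a ha n).tsum_eq_zero_add, mul_add, ← tsum_mul_left]
  have : x * ((a (n + 0) : ℝ) / x ^ (0 + 1)) = a n := by
    simp; field_simp
  rw [this, add_sub_cancel_left]
  refine tsum_congr fun i => ?_
  rw [show n + 1 + i = n + (i + 1) by ring]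
  field_simp
  ring

lemma tl_pos (x : ℝ) (hx : 1 < x) (a : ℕ → ℕ) (ha : ∀ i, a i ≤ 1) (hz : notEndZero a) (n : ℕ) :
    0 < tl x a n := by
  obtain ⟨m, hm, h⟩ := hz n
  have h0 : 0 < x := by linarith
  refine (tl_summable x hx a ha n).tsum_pos (fun i => by positivity) (m - n) ?_
  rw [show n + (m - n) = m by omega]
  have : 0 < a m := by omega
  positivity

lemma tl_strict (x y : ℝ) (hx : 1 < x) (hxy : x < y) (a : ℕ → ℕ) (ha : ∀ i, a i ≤ 1)
    (hz : notEndZero a) (n : ℕ) : tl y a n < tl x a n := by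
  obtain ⟨m, hm, h⟩ := hz n
  have h0 : 0 < x := by linarith
  refine Summable.tsum_lt_tsum (i := m - n) (fun i => ?_) ?_ (tl_summable y (hx.trans hxy) a ha n)
    (tl_summable x hx a ha n)
  · gcongr
  · rw [show n + (m - n) = m by omega]
    have : 0 < (a m : ℝ) := by exact_mod_cast Nat.pos_of_ne_zero h
    have h3 : x ^ (m - n + 1) < y ^ (m - n + 1) := by gcongr
    exact div_lt_div_of_pos_left this (by positivity) h3

lemma tl_diff (x : ℝ) (hx : 1 < x) (a b : ℕ → ℕ) (ha : ∀ i, a i ≤ 1) (hb : ∀ i, b i ≤ 1) (n : ℕ)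
    (h : ∀ i < n, a i = b i) : tl x a n - tl x b n = x ^ n * (tl x a 0 - tl x b 0) := by
  induction n with
  | zero => simp
  | succ k ih =>
    have := ih fun i hi => h i (by omega)
    rw [tl_succ x hx a ha, tl_succ x hx b hb, h k (by omega), pow_succ']
    linear_combination x * this

open Classical in
noncomputable def rem (q : ℝ) : ℕ → ℝ
  | 0 => 1
  | n + 1 => q * rem q n - (if 1 < q * rem q n then 1 else 0)

open Classical in
noncomputable def dig (q : ℝ) (n : ℕ) : ℕ := if 1 < q * rem q n then 1 else 0

lemma rem_succ (q : ℝ) (n : ℕ) : rem q (n + 1) = q * rem q n - dig q n := by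
  simp [rem, dig]

lemma dig_le (q : ℝ) (n : ℕ) : dig q n ≤ 1 := by
  unfold dig; split_ifs <;> simp

lemma rem_mem (q : ℝ) (h1 : 1 < q) (h2 : q ≤ 2) (n : ℕ) : 0 < rem q n ∧ rem q n ≤ 1 := by
  induction n with
  | zero => simp [rem]
  | succ k ih =>
    obtain ⟨h3, h4⟩ := ih
    rw [rem]
    split_ifs with h
    · constructor <;> nlinarith
    · constructor <;> nlinarith

lemma rem_eq (q : ℝ) (h1 : 1 < q) (h2 : q ≤ 2) (n : ℕ) : rem q n = tl q (dig q) n := by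
  have key : ∀ n, rem q n - tl q (dig q) n = q ^ n * (rem q 0 - tl q (dig q) 0) := by
    intro n
    induction n with
    | zero => simp
    | succ k ih =>
      rw [rem_succ, tl_succ q h1 _ (dig_le q), pow_succ']
      linear_combination q * ih
  have hz : rem q 0 - tl q (dig q) 0 = 0 := by
    by_contra hne
    set C := ∑' i : ℕ, (1 : ℝ) / q ^ (i + 1) with hC
    have hpos : 0 < |rem q 0 - tl q (dig q) 0| := abs_pos.2 hne
    obtain ⟨n, hn⟩ := pow_unbounded_of_one_lt ((1 + C) / |rem q 0 - tl q (dig q) 0|) h1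
    rw [div_lt_iff₀ hpos] at hn
    have hk := congrArg abs (key n)
    rw [abs_mul, abs_of_pos (show 0 < q ^ n by have : 0 < q := by linarith
                                               positivity)] at hk
    rw [← hk] at hn
    have a1 := rem_mem q h1 h2 n
    have a2 := tl_nonneg q h1 (dig q) n
    have a3 := tl_le q h1 (dig q) (dig_le q) n
    have : |rem q n - tl q (dig q) n| ≤ 1 + C := by
      rw [abs_le]; constructor <;> linarith
    linarith
  have := key n
  rw [hz] at this
  linarith

lemma dig_notEnd (q : ℝ) (h1 : 1 < q) (h2 : q ≤ 2) : notEndZero (dig q) := by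
  intro n
  by_contra! h
  have a1 := (rem_mem q h1 h2 n).1
  rw [rem_eq q h1 h2] at a1
  have : tl q (dig q) n = 0 := by
    unfold tl
    simp [h]
  linarith

lemma tl_zero (q : ℝ) (a : ℕ → ℕ) : tl q a 0 = ∑' i : ℕ, (a i : ℝ) / q ^ (i + 1) := by
  simp [tl]

lemma qg_tail (q : ℝ) (h1 : 1 < q) (h2 : q ≤ 2) (γ : ℕ → ℕ) (h : isQuasiGreedy q γ) (n : ℕ) :
    tl q γ n ≤ 1 := by
  obtain ⟨hd, hz, hs, hm⟩ := h
  have hv : tl q (dig q) 0 = 1 := by rw [← rem_eq q h1 h2]; simp [rem]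
  rcases hm (dig q) (dig_le q) (dig_notEnd q h1 h2) (by rw [← tl_zero, hv]) with ⟨k, hk, hlt⟩ | heq
  · exfalso
    have e := tl_diff q h1 _ _ (dig_le q) hd k hk
    rw [hv, tl_zero q γ, hs] at e
    have p1 := tl_pos q h1 γ hd hz (k + 1)
    rw [tl_succ q h1 γ hd] at p1
    have g1 : γ k = 1 := by have := hd k; omega
    have d0 : dig q k = 0 := by have := hd k; omega
    have : ¬ 1 < q * rem q k := by
      intro hh
      simp [dig, hh] at d0
    rw [rem_eq q h1 h2, show tl q (dig q) k = tl q γ k by linarith] at this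
    rw [g1] at p1
    push_cast at p1
    linarith
  · rw [← heq, ← rem_eq q h1 h2]
    exact (rem_mem q h1 h2 n).2

lemma piZero_eq (β : ℝ) (γ : ℕ → ℕ) : piZero β γ = tl β γ 0 / β := by
  rw [tl_zero, piZero, ← tsum_div_const]
  refine tsum_congr fun i => ?_
  rw [div_div, ← pow_succ]

/-- If `a` and `b` first differ at `n` with `a n < b n`, and the tail of `a` is at most `1`. -/
lemma lex_val (x : ℝ) (hx : 1 < x) (a b : ℕ → ℕ) (ha : ∀ i, a i ≤ 1) (hb : ∀ i, b i ≤ 1)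
    (hz : notEndZero b) (n : ℕ) (h : ∀ i < n, a i = b i) (hlt : a n < b n)
    (ht : tl x a (n + 1) ≤ 1) : tl x a 0 < tl x b 0 := by
  have e := tl_diff x hx a b ha hb n h
  have p1 := tl_pos x hx b hb hz (n + 1)
  rw [tl_succ x hx b hb] at p1
  rw [tl_succ x hx a ha] at ht
  have hn : (a n : ℝ) + 1 ≤ b n := by exact_mod_cast hlt
  have h0 : 0 < x := by linarith
  have h3 : x * (tl x a n - tl x b n) < 0 := by linarith
  rw [e, ← mul_assoc] at h3
  have : 0 < x * x ^ n := by positivity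
  nlinarith

theorem Phi_beta_strictMono
    (β : ℝ) (hβ : β ∈ Set.Ioc (1 : ℝ) 2)
    (p q : ℝ) (hp : p ∈ Set.Ico ((1 + Real.sqrt 5) / 2) β)
    (hq : q ∈ Set.Ico ((1 + Real.sqrt 5) / 2) β) (hpq : p < q)
    (γp γq : ℕ → ℕ) (hγp : isQuasiGreedy p γp) (hγq : isQuasiGreedy q γq) :
    piZero β γp < piZero β γq := by
  obtain ⟨hb1, hb2⟩ := hβ
  obtain ⟨hp1, hp2⟩ := hp
  obtain ⟨-, hq2⟩ := hq
  have h5 : 1 < Real.sqrt 5 := by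
    rw [Real.lt_sqrt] <;> norm_num
  have p1 : 1 < p := by linarith
  have q1 : 1 < q := by linarith
  have tp := qg_tail p p1 (by linarith) γp hγp
  have tq := qg_tail q q1 (by linarith) γq hγq
  obtain ⟨dp, zp, sp, -⟩ := hγp
  obtain ⟨dq, zq, sq, -⟩ := hγq
  rw [← tl_zero] at sp sq
  have hlt : tl q γp 0 < tl q γq 0 := by
    rw [sq, ← sp]
    exact tl_strict p q p1 hpq γp dp zp 0
  have hne : ∃ n, γp n ≠ γq n := by
    by_contra! h
    rw [funext h] at hlt
    exact lt_irrefl _ hlt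
  classical
  have hn := Nat.find_spec hne
  have hmin : ∀ i < Nat.find hne, γp i = γq i := fun i hi => not_not.1 (Nat.find_min hne hi)
  rw [piZero_eq, piZero_eq]
  apply div_lt_div_of_pos_right _ (by linarith)
  rcases lt_or_gt_of_ne hn with h | h
  · exact lex_val β hb1 γp γq dp dq zq _ hmin h
      ((tl_strict p β p1 hp2 γp dp zp _).le.trans (tp _))
  · exact absurd (lex_val q q1 γq γp dq dp zp _ (fun i hi => (hmin i hi).symm) h (tq _)) hlt.not_gt
end

section
/- Let β ∈ (1,2) and let x ∈ (0, 1/(β−1)) with x ∉ O_β = [1/(β²−1), β/(β²−1)]. Then there exist k ∈ ℕ and i ∈ {0,1} such that T_i^k(x) ∈ O_β, where T_0(x) = βx and T_1(x) = βx − 1. In particular, every point of (0, 1/(β−1)) is eventually mapped into the attractor O_β. -/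
lemma scale_into (β c y : ℝ) (hβ : 1 < β) (hy : 0 < y) (hyc : y ≤ β * c) :
    ∃ k : ℕ, c ≤ β ^ k * y ∧ β ^ k * y ≤ β * c := by
  obtain ⟨n, h1, h2⟩ := exists_nat_pow_near ((one_le_div hy).2 hyc) hβ
  rw [le_div_iff₀ hy] at h1
  rw [div_lt_iff₀ hy, pow_succ] at h2
  refine ⟨n, ?_, h1⟩
  have : β * c < β * (β ^ n * y) := by linarith
  exact (lt_of_mul_lt_mul_left this (by linarith)).le

lemma iter_zero (β x : ℝ) (k : ℕ) : (fun y => β * y)^[k] x = β ^ k * x := by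
  induction k with
  | zero => simp
  | succ k ih => rw [Function.iterate_succ_apply', ih]; ring

lemma iter_one (β x s : ℝ) (hs : β * s - 1 = s) (k : ℕ) :
    (fun y => β * y - 1)^[k] x = s - β ^ k * (s - x) := by
  induction k with
  | zero => simp
  | succ k ih =>
    rw [Function.iterate_succ_apply', ih, pow_succ]
    linear_combination hs

theorem eventually_mapped_into_attractor
    (β : ℝ) (hβ : β ∈ Set.Ioo (1 : ℝ) 2)
    (x : ℝ) (hx : x ∈ Set.Ioo (0 : ℝ) (1 / (β - 1)))
    (hxO : x ∉ Set.Icc (1 / (β ^ 2 - 1)) (β / (β ^ 2 - 1))) :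
    ∃ k : ℕ,
      (fun y => β * y)^[k] x ∈ Set.Icc (1 / (β ^ 2 - 1)) (β / (β ^ 2 - 1)) ∨
      (fun y => β * y - 1)^[k] x ∈ Set.Icc (1 / (β ^ 2 - 1)) (β / (β ^ 2 - 1)) := by
  obtain ⟨h1, -⟩ := hβ
  obtain ⟨hx0, hx1⟩ := hx
  have ha : β - 1 ≠ 0 := by linarith
  have hb : β ^ 2 - 1 ≠ 0 := by nlinarith
  have hcpos : 0 < 1 / (β ^ 2 - 1) := one_div_pos.2 (by nlinarith)
  have e1 : β / (β ^ 2 - 1) = β * (1 / (β ^ 2 - 1)) := by ring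
  have hc1 : 1 / (β ^ 2 - 1) * (β ^ 2 - 1) = 1 := one_div_mul_cancel hb
  have e2 : 1 / (β - 1) = (β + 1) * (1 / (β ^ 2 - 1)) := by
    rw [div_eq_iff ha]; linear_combination -hc1
  rw [e1] at *
  rw [e2] at hx1
  generalize 1 / (β ^ 2 - 1) = c at *
  by_cases h : x ≤ β * c
  · obtain ⟨k, h2, h3⟩ := scale_into β c x h1 hx0 h
    exact ⟨k, Or.inl (by rw [iter_zero]; exact ⟨h2, h3⟩)⟩
  · obtain ⟨k, h2, h3⟩ := scale_into β c ((β + 1) * c - x) h1 (by linarith) (by nlinarith)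
    refine ⟨k, Or.inr ?_⟩
    rw [iter_one β x ((β + 1) * c) (by linear_combination hc1)]
    constructor <;> linarith
end

section
/- Let β_T ∈ (1,2) be the unique root of x³ − x² − 2x + 1 = 0 in (1,2), and let T_0(x) = β_T x, T_1(x) = β_T x − 1, O_{β_T} = [1/(β_T²−1), β_T/(β_T²−1)]. For every J ∈ ℕ there exists δ_J > 0 such that: (i) for all x ∈ [1/β_T, 1/β_T + δ_J), ((T_1 ∘ T_0)^J ∘ T_1 ∘ T_1 ∘ T_0)(x) ∈ O_{β_T}; and (ii) for all x ∈ (1/(β_T(β_T−1)) − δ_J, 1/(β_T(β_T−1))], ((T_0 ∘ T_1)^J ∘ T_0 ∘ T_0 ∘ T_1)(x) ∈ O_{β_T}. -/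
theorem iter_affine_aux (c p : ℝ) (f : ℝ → ℝ) (hf : ∀ e, f (p + e) = p + c * e) (J : ℕ) (e : ℝ) :
    f^[J] (p + e) = p + c ^ J * e := by
  induction J generalizing e with
  | zero => simp
  | succ n ih =>
    rw [Function.iterate_succ_apply, hf, ih]
    ring

theorem betaT_delta_return_to_attractor
    (βT : ℝ) (hβT : βT ∈ Set.Ioo (1 : ℝ) 2)
    (hroot : βT ^ 3 - βT ^ 2 - 2 * βT + 1 = 0)
    (J : ℕ) :
    ∃ δ > (0 : ℝ),
      (∀ x ∈ Set.Ico (1 / βT) (1 / βT + δ),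
        (fun y => βT * (βT * y) - 1)^[J] (βT * (βT * (βT * x) - 1) - 1) ∈
          Set.Icc (1 / (βT ^ 2 - 1)) (βT / (βT ^ 2 - 1))) ∧
      (∀ x ∈ Set.Ioc (1 / (βT * (βT - 1)) - δ) (1 / (βT * (βT - 1))),
        (fun y => βT * (βT * y - 1))^[J] (βT * (βT * (βT * x - 1))) ∈
          Set.Icc (1 / (βT ^ 2 - 1)) (βT / (βT ^ 2 - 1))) := by
  obtain ⟨h1, h2⟩ := hβT
  have hb : 0 < βT := by linarith
  have hb1 : βT - 1 ≠ 0 := by intro h; linarith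
  have hq : 0 < βT ^ 2 - 1 := by nlinarith
  have hp : βT * (βT - 1) - 1 = 1 / (βT ^ 2 - 1) := by
    rw [eq_div_iff hq.ne']
    linear_combination βT * hroot
  have hp' : βT * (βT * (βT * (1 / (βT * (βT - 1))) - 1)) = βT / (βT ^ 2 - 1) := by
    have e : βT * (1 / (βT * (βT - 1))) = 1 / (βT - 1) := by field_simp
    have e2 : (1 / (βT - 1)) * (βT ^ 2 - 1) = βT + 1 := by field_simp; ring
    rw [e, eq_div_iff hq.ne']
    linear_combination βT ^ 2 * e2 - βT * hroot
  have hpq : βT / (βT ^ 2 - 1) = 1 / (βT ^ 2 - 1) + 1 / (βT + 1) := by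
    have : βT + 1 ≠ 0 := by positivity
    have := hq.ne'
    field_simp
    ring
  have hinv : 1 / (βT ^ 2 - 1) * (βT ^ 2 - 1) = 1 := by field_simp
  have hinv' : βT / (βT ^ 2 - 1) * (βT ^ 2 - 1) = βT := by field_simp
  have hbi : βT * (1 / βT) = 1 := by field_simp
  have hc : 0 < (βT ^ 2) ^ J * βT ^ 3 := by positivity
  have hd : (βT ^ 2) ^ J * βT ^ 3 * (1 / (βT + 1) / ((βT ^ 2) ^ J * βT ^ 3)) = 1 / (βT + 1) := by
    field_simp
  refine ⟨1 / (βT + 1) / ((βT ^ 2) ^ J * βT ^ 3), by positivity, ?_, ?_⟩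
  · rintro x ⟨hx1, hx2⟩
    have e : βT * (βT * (βT * x) - 1) - 1 = 1 / (βT ^ 2 - 1) + βT ^ 3 * (x - 1 / βT) := by
      linear_combination hp + βT ^ 2 * hbi
    rw [e, iter_affine_aux (βT ^ 2) _ _ (by intro e; linear_combination hinv), hpq]
    have k1 := mul_nonneg hc.le (sub_nonneg.2 hx1)
    have k2 := mul_lt_mul_of_pos_left hx2 hc
    constructor <;> linarith
  · rintro x ⟨hx1, hx2⟩
    have e : βT * (βT * (βT * x - 1)) =
        βT / (βT ^ 2 - 1) + βT ^ 3 * (x - 1 / (βT * (βT - 1))) := by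
      linear_combination hp'
    rw [e, iter_affine_aux (βT ^ 2) _ _ (by intro e; linear_combination hinv')]
    have k1 := mul_nonneg hc.le (sub_nonneg.2 hx2)
    have k2 := mul_lt_mul_of_pos_left hx1 hc
    constructor <;> linarith
end

section
/- Let β ∈ (1,2) be the root of x⁴ − x³ − x² − x − 1 = 0 in (1,2) (the multinacci number, β ≈ 1.92756). For each integer k ≥ 1, the number x_k := π_β(0 1^{4k−1}(011)^∞) has exactly k distinct β-expansions, and every β-expansion of x_k ends in (011)^∞; in particular, none of the β-expansions of x_k is simply normal. -/
/-- `ε` is a β-expansion of `x`. -/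
def isExpansion (β x : ℝ) (ε : ℕ → ℕ) : Prop :=
  (∀ i, ε i ≤ 1) ∧ x = ∑' i : ℕ, (ε i : ℝ) / β ^ (i + 1)

/-- The sequence `0 1^{4k-1} (011)^∞` (indexed from 0). -/
def multinacciSeq (k : ℕ) : ℕ → ℕ := fun i =>
  if i = 0 then 0
  else if i < 4 * k then 1
  else if (i - 4 * k) % 3 = 0 then 0 else 1

/-- `ε` ends in `(011)^∞`. -/
def endsIn011 (ε : ℕ → ℕ) : Prop :=
  ∃ N : ℕ, ∀ i : ℕ, ε (N + i) = if i % 3 = 0 then 0 else 1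

namespace MN

def cs (d : ℕ) (ε : ℕ → ℕ) : ℕ → ℕ
  | 0 => d
  | n + 1 => ε n

lemma cs_eta (ε : ℕ → ℕ) : cs (ε 0) (fun i => ε (i + 1)) = ε := by
  funext i; cases i <;> rfl

lemma cs_inj {d : ℕ} {e f : ℕ → ℕ} (h : cs d e = cs d f) : e = f := by
  funext i; exact congrFun h (i + 1)

/-- the periodic sequence (011)^∞ -/
def p : ℕ → ℕ := fun i => if i % 3 = 0 then 0 else 1

/-- 1^j (011)^∞ -/
def w : ℕ → ℕ → ℕ
  | 0 => p
  | j + 1 => cs 1 (w j)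

lemma w_apply (j i : ℕ) : w j i = if i < j then 1 else p (i - j) := by
  induction j generalizing i with
  | zero => simp [w]
  | succ j ih =>
    cases i with
    | zero => simp [w, cs]
    | succ i => simp [w, cs, ih]

lemma seq_eq (m : ℕ) : multinacciSeq (m + 1) = cs 0 (w (4 * m + 3)) := by
  funext i
  cases i with
  | zero => simp [multinacciSeq, cs]
  | succ i =>
    simp only [multinacciSeq, cs, w_apply, p]
    have h1 : i + 1 ≠ 0 := by omega
    have h2 : (i + 1 < 4 * (m + 1)) ↔ i < 4 * m + 3 := by omega
    have h3 : i + 1 - 4 * (m + 1) = i - (4 * m + 3) := by omega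
    simp only [h1, h2, h3, if_false]

lemma not_sn {ε : ℕ → ℕ} (h : endsIn011 ε) : ¬ simplyNormal ε := by
  obtain ⟨N, hN⟩ := h
  intro hs
  have key : ∀ m, ((Finset.range (N + 3 * m)).filter fun i => ε i = 0).card ≤ N + m := by
    intro m
    induction m with
    | zero =>
      refine (Finset.card_filter_le _ _).trans ?_
      simp
    | succ m ih =>
      have e : N + 3 * (m + 1) = N + 3 * m + 1 + 1 + 1 := by ring
      have h1 : ε (N + 3 * m + 1) = 1 := by
        rw [add_assoc, hN, if_neg (by omega)]
      have h2 : ε (N + 3 * m + 1 + 1) = 1 := by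
        rw [add_assoc, add_assoc, hN, if_neg (by omega)]
      have h0 : ε (N + 3 * m) = 0 := by
        rw [hN, if_pos (by omega)]
      rw [e, Finset.range_add_one, Finset.filter_insert, if_neg (by rw [h2]; norm_num), Finset.range_add_one,
        Finset.filter_insert, if_neg (by rw [h1]; norm_num), Finset.range_add_one,
        Finset.filter_insert, if_pos h0]
      refine (Finset.card_insert_le _ _).trans ?_
      omega
  have ev := hs.eventually (lt_mem_nhds (show (2 / 5 : ℝ) < 1 / 2 by norm_num))
  obtain ⟨A, hA⟩ := Filter.eventually_atTop.1 ev
  have hh := hA (N + 3 * (3 * N + A + 1)) (by omega)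
  have kk := key (3 * N + A + 1)
  have kk' : (((Finset.range (N + 3 * (3 * N + A + 1))).filter fun i => ε i = 0).card : ℝ)
      ≤ N + (3 * N + A + 1) := by exact_mod_cast kk
  have pos : (0 : ℝ) < ((N + 3 * (3 * N + A + 1) : ℕ) : ℝ) := by
    exact_mod_cast (by omega : 0 < N + 3 * (3 * N + A + 1))
  rw [lt_div_iff₀ pos] at hh
  push_cast at hh
  have : (0 : ℝ) ≤ A := Nat.cast_nonneg _
  linarith

lemma ends_cs {d : ℕ} {ε : ℕ → ℕ} (h : endsIn011 ε) : endsIn011 (cs d ε) := by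
  obtain ⟨N, hN⟩ := h
  refine ⟨N + 1, fun i => ?_⟩
  rw [← hN i, show N + 1 + i = (N + i) + 1 by ring]
  rfl

lemma ends_w (j : ℕ) : endsIn011 (w j) := by
  induction j with
  | zero => exact ⟨0, fun i => by simp [w, p]⟩
  | succ j ih => exact ends_cs ih

section
variable {β : ℝ}

lemma summ (h1 : 1 < β) {ε : ℕ → ℕ} (h : ∀ i, ε i ≤ 1) :
    Summable (fun i : ℕ => (ε i : ℝ) / β ^ (i + 1)) := by
  have hg : Summable (fun i : ℕ => (β⁻¹) ^ (i + 1)) :=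
    (summable_nat_add_iff 1).2
      (summable_geometric_of_lt_one (by positivity) (inv_lt_one_of_one_lt₀ h1))
  refine Summable.of_nonneg_of_le (fun i => by positivity) (fun i => ?_) hg
  rw [inv_pow, ← one_div]
  have : (ε i : ℝ) ≤ 1 := by exact_mod_cast h i
  gcongr

lemma geo (h1 : 1 < β) : ∑' i : ℕ, (1 : ℝ) / β ^ (i + 1) = 1 / (β - 1) := by
  have h0 : β ≠ 0 := by positivity
  have hb : β - 1 ≠ 0 := by linarith
  have e : (fun i : ℕ => (1 : ℝ) / β ^ (i + 1)) = fun i : ℕ => β⁻¹ * (β⁻¹) ^ i := by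
    funext i; rw [one_div, ← inv_pow, pow_succ']
  rw [e, tsum_mul_left, tsum_geometric_of_lt_one (by positivity) (inv_lt_one_of_one_lt₀ h1)]
  have : 1 - β⁻¹ ≠ 0 := by
    have := inv_lt_one_of_one_lt₀ h1
    linarith
  field_simp

lemma bounds (h1 : 1 < β) {x : ℝ} {ε : ℕ → ℕ} (h : isExpansion β x ε) :
    0 ≤ x ∧ x ≤ 1 / (β - 1) := by
  obtain ⟨hd, rfl⟩ := h
  refine ⟨tsum_nonneg fun i => by positivity, ?_⟩
  rw [← geo h1]
  have hs := summ h1 (ε := fun _ => 1) (fun _ => le_rfl)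
  simp only [Nat.cast_one] at hs
  refine (summ h1 hd).tsum_le_tsum (fun i => ?_) hs
  have : (ε i : ℝ) ≤ 1 := by exact_mod_cast hd i
  gcongr

lemma exp_step (h1 : 1 < β) {x : ℝ} {ε : ℕ → ℕ} :
    isExpansion β x ε ↔ ε 0 ≤ 1 ∧ isExpansion β (β * x - ε 0) (fun i => ε (i + 1)) := by
  have h0 : β ≠ 0 := by positivity
  have key : (∀ i, ε i ≤ 1) → β * (∑' i : ℕ, (ε i : ℝ) / β ^ (i + 1)) - ε 0
      = ∑' i : ℕ, (ε (i + 1) : ℝ) / β ^ (i + 1) := by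
    intro hd
    rw [(summ h1 hd).tsum_eq_zero_add, mul_add, ← tsum_mul_left]
    have : ∀ i : ℕ, β * ((ε (i + 1) : ℝ) / β ^ (i + 1 + 1)) = (ε (i + 1) : ℝ) / β ^ (i + 1) := by
      intro i; field_simp; ring
    simp only [this]
    field_simp
    ring
  constructor
  · rintro ⟨hd, rfl⟩
    exact ⟨hd 0, fun i => hd _, key hd⟩
  · rintro ⟨hd0, hd, hx⟩
    have hd' : ∀ i, ε i ≤ 1 := by
      intro i; cases i with
      | zero => exact hd0
      | succ i => exact hd i
    refine ⟨hd', ?_⟩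
    rw [← key hd'] at hx
    exact mul_left_cancel₀ h0 (by linarith)

lemma exp_cs (h1 : 1 < β) {x y : ℝ} {d : ℕ} {ε : ℕ → ℕ} (hd : d ≤ 1) (hy : y = β * x - d)
    (h : isExpansion β y ε) : isExpansion β x (cs d ε) := by
  subst hy
  exact (exp_step h1).2 ⟨hd, h⟩

lemma force0 (h1 : 1 < β) {x y : ℝ} {ε : ℕ → ℕ} (h : isExpansion β x ε) (hx : β * x < 1)
    (hy : y = β * x) :
    ε 0 = 0 ∧ isExpansion β y (fun i => ε (i + 1)) := by
  obtain ⟨hd, he⟩ := (exp_step h1).1 h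
  have hb := (bounds h1 he).1
  have : ε 0 = 0 := by
    by_contra hne
    have : ε 0 = 1 := by omega
    rw [this] at hb
    push_cast at hb
    linarith
  refine ⟨this, ?_⟩
  rw [this] at he
  simpa [hy] using he

lemma force1 (h1 : 1 < β) {x y : ℝ} {ε : ℕ → ℕ} (h : isExpansion β x ε)
    (hx : 1 / (β - 1) < β * x) (hy : y = β * x - 1) :
    ε 0 = 1 ∧ isExpansion β y (fun i => ε (i + 1)) := by
  obtain ⟨hd, he⟩ := (exp_step h1).1 h
  have hb := (bounds h1 he).2
  have : ε 0 = 1 := by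
    by_contra hne
    have : ε 0 = 0 := by omega
    rw [this] at hb
    push_cast at hb
    linarith
  refine ⟨this, ?_⟩
  rw [this] at he
  simpa [hy] using he

/-- value of 1^j (011)^∞ -/
noncomputable def v (β : ℝ) : ℕ → ℝ
  | 0 => (β + 1) / (β ^ 3 - 1)
  | j + 1 => (1 + v β j) / β


lemma v_succ (h1 : 1 < β) (j : ℕ) : β * v β (j + 1) = 1 + v β j := by
  have h0 : β ≠ 0 := by positivity
  simp only [v]; field_simp

lemma cube_pos (h1 : 1 < β) : 0 < β ^ 3 - 1 := by
  have := one_lt_pow₀ h1 (n := 3) (by norm_num)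
  linarith

lemma v0 (h1 : 1 < β) : β ^ 3 * v β 0 = β + 1 + v β 0 := by
  have := cube_pos h1
  simp only [v]; field_simp; ring

lemma v2 (h1 : 1 < β) : β * v β 0 = v β 2 := by
  have h0 : β ≠ 0 := by positivity
  have a := v0 h1
  have b := v_succ h1 0
  have c := v_succ h1 1
  norm_num at b c
  refine mul_left_cancel₀ (pow_ne_zero 2 h0) ?_
  linear_combination a - b - β * c

lemma blow (h1 : 1 < β) (h2 : β < 2) (hr : β ^ 4 - β ^ 3 - β ^ 2 - β - 1 = 0) : 3 / 2 < β := by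
  by_contra h
  push Not at h
  nlinarith [mul_pos (sub_pos.2 h1) (sub_pos.2 h1), sq_nonneg β, mul_nonneg (sq_nonneg β) (sub_nonneg.2 h), pow_pos (by linarith : 0 < β) 3]

lemma v0_lt (h1 : 1 < β) (h2 : β < 2) (hr : β ^ 4 - β ^ 3 - β ^ 2 - β - 1 = 0) : β * v β 0 < 1 := by
  have := cube_pos h1
  simp only [v]
  rw [← mul_div_assoc, div_lt_one this]
  have : 0 < β * (β ^ 3 - β ^ 2 - β - 1) := by linarith
  have := pos_of_mul_pos_right this (by linarith)
  linarith

lemma v0_pos (h1 : 1 < β) : 0 < v β 0 := by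
  have := cube_pos h1
  simp only [v]; positivity

lemma v_ge (h1 : 1 < β) (h2 : β < 2) (hr : β ^ 4 - β ^ 3 - β ^ 2 - β - 1 = 0) (j : ℕ) : v β 0 ≤ v β j := by
  induction j with
  | zero => exact le_rfl
  | succ j ih =>
    have := v_succ h1 j
    have := v0_lt h1 h2 hr
    have := v0_pos h1
    nlinarith

lemma M_lt (h1 : 1 < β) (h2 : β < 2) (hr : β ^ 4 - β ^ 3 - β ^ 2 - β - 1 = 0) : 1 / (β - 1) < 1 + v β 0 := by
  have hc := cube_pos h1
  have := blow h1 h2 hr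
  have hb : 0 < β - 1 := by linarith
  rw [div_lt_iff₀ hb]
  simp only [v]
  rw [show β ^ 3 - 1 = (β - 1) * (β ^ 2 + β + 1) by ring]
  have hq : 0 < β ^ 2 + β + 1 := by positivity
  have e : (1 + (β + 1) / ((β - 1) * (β ^ 2 + β + 1))) * (β - 1)
    = (β - 1) + (β + 1) / (β ^ 2 + β + 1) := by field_simp
  rw [e, ← sub_lt_iff_lt_add', lt_div_iff₀ hq]
  nlinarith [mul_pos hb hb, mul_pos hb (sub_pos.2 h2)]

lemma v_lt (h1 : 1 < β) (h2 : β < 2) (hr : β ^ 4 - β ^ 3 - β ^ 2 - β - 1 = 0) (j : ℕ) : v β j < 1 / (β - 1) := by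
  have hb : 0 < β - 1 := by linarith
  have e : 1 / (β - 1) * (β - 1) = 1 := by field_simp
  induction j with
  | zero =>
    have h := v0_lt h1 h2 hr
    have := v0_pos h1
    rw [lt_div_iff₀ hb]
    nlinarith
  | succ j ih =>
    have := v_succ h1 j
    nlinarith

lemma v_force (h1 : 1 < β) (h2 : β < 2) (hr : β ^ 4 - β ^ 3 - β ^ 2 - β - 1 = 0) (j : ℕ) : 1 / (β - 1) < β * v β (j + 1) := by
  rw [v_succ h1]
  have := M_lt h1 h2 hr
  have := v_ge h1 h2 hr j
  linarith

lemma v_lt_beta (h1 : 1 < β) (h2 : β < 2) (hr : β ^ 4 - β ^ 3 - β ^ 2 - β - 1 = 0) (j : ℕ) : v β j < β := by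
  have h := v_lt h1 h2 hr j
  have hb := blow h1 h2 hr
  have h3 : v β 0 < 1 := by
    have := v0_lt h1 h2 hr
    have := v0_pos h1
    nlinarith
  by_contra hc
  push Not at hc
  have : β * (β - 1) < 1 := by
    rw [← lt_div_iff₀ (by linarith)]; linarith
  have e : β * β ^ 3 = β * (β ^ 2 + β + 1) + 1 := by linarith
  nlinarith [mul_pos (sub_pos.2 h1) (sub_pos.2 h2), mul_pos (sub_pos.2 h1) (sub_pos.2 h1), sq_nonneg (β^2 - β - 1)]

lemma v3_lt (h1 : 1 < β) (h2 : β < 2) (hr : β ^ 4 - β ^ 3 - β ^ 2 - β - 1 = 0) : v β 3 < 1 := by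
  have a := v_succ h1 0
  have b := v_succ h1 1
  have c := v_succ h1 2
  norm_num at a b c
  have e : β ^ 3 * v β 3 = β ^ 2 + β + 1 + v β 0 := by
    linear_combination β ^ 2 * c + β * b + a
  have h := v0_lt h1 h2 hr
  by_contra hc
  push Not at hc
  have hp : 0 < β ^ 4 := by positivity
  nlinarith

lemma v4 (h1 : 1 < β) (hr : β ^ 4 - β ^ 3 - β ^ 2 - β - 1 = 0) (n : ℕ) : β ^ 4 * (v β (n + 4) - 1) = v β n := by
  have a := v_succ h1 n
  have b := v_succ h1 (n + 1)
  have c := v_succ h1 (n + 2)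
  have d := v_succ h1 (n + 3)
  linear_combination β ^ 3 * d + β ^ 2 * c + β * b + a - hr

lemma exp_p (h1 : 1 < β) : isExpansion β (v β 0) p := by
  have hd : ∀ i, p i ≤ 1 := by intro i; simp only [p]; split_ifs <;> norm_num
  have h : isExpansion β (∑' i : ℕ, (p i : ℝ) / β ^ (i + 1)) p := ⟨hd, rfl⟩
  obtain ⟨-, e1⟩ := (exp_step h1).1 h
  obtain ⟨-, e2⟩ := (exp_step h1).1 e1
  obtain ⟨-, e3⟩ := (exp_step h1).1 e2
  have hp : (fun i => p (i + 1 + 1 + 1)) = p := by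
    funext i
    simp only [p]
    rw [show (i + 1 + 1 + 1) % 3 = i % 3 by omega]
  have h3 := e3.2
  change _ = ∑' i : ℕ, (((fun i => p (i + 1 + 1 + 1)) i : ℕ) : ℝ) / β ^ (i + 1) at h3
  rw [hp] at h3
  norm_num [p] at h3
  refine ⟨hd, ?_⟩
  have hc := cube_pos h1
  simp only [v]
  rw [div_eq_iff hc.ne']
  simp only [p]
  push_cast
  linarith

lemma exp_w (h1 : 1 < β) (j : ℕ) : isExpansion β (v β j) (w j) := by
  induction j with
  | zero => exact exp_p h1
  | succ j ih =>
    refine exp_cs h1 le_rfl ?_ ih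
    rw [v_succ h1]; simp

lemma uniq_p_step (h1 : 1 < β) (h2 : β < 2) (hr : β ^ 4 - β ^ 3 - β ^ 2 - β - 1 = 0) {ε : ℕ → ℕ} (h : isExpansion β (v β 0) ε) :
    ε 0 = 0 ∧ ε 1 = 1 ∧ ε 2 = 1 ∧ isExpansion β (v β 0) (fun i => ε (i + 3)) := by
  obtain ⟨a, ha⟩ := force0 h1 h (v0_lt h1 h2 hr) (v2 h1).symm
  obtain ⟨b, hb⟩ := force1 h1 ha (v_force h1 h2 hr 1) (y := v β 1)
    (by rw [v_succ h1]; ring)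
  obtain ⟨c, hc⟩ := force1 h1 hb (v_force h1 h2 hr 0) (y := v β 0)
    (by rw [v_succ h1]; ring)
  exact ⟨a, b, c, hc⟩

lemma uniq_p (h1 : 1 < β) (h2 : β < 2) (hr : β ^ 4 - β ^ 3 - β ^ 2 - β - 1 = 0) {ε : ℕ → ℕ} (h : isExpansion β (v β 0) ε) : ε = p := by
  have key : ∀ n : ℕ, ∀ ε : ℕ → ℕ, isExpansion β (v β 0) ε → ε n = p n := by
    intro n
    induction n using Nat.strong_induction_on with
    | _ n ih =>
      intro ε h
      obtain ⟨a, b, c, d⟩ := uniq_p_step h1 h2 hr h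
      match n, ih with
      | 0, _ => simpa [p] using a
      | 1, _ => simpa [p] using b
      | 2, _ => simpa [p] using c
      | n + 3, ih =>
        have := ih n (by omega) _ d
        simp only [p] at this ⊢
        rw [this, show (n + 3) % 3 = n % 3 by omega]
  funext n
  exact key n ε h

lemma uniq_w (h1 : 1 < β) (h2 : β < 2) (hr : β ^ 4 - β ^ 3 - β ^ 2 - β - 1 = 0) (j : ℕ) {ε : ℕ → ℕ} (h : isExpansion β (v β j) ε) : ε = w j := by
  induction j generalizing ε with
  | zero => exact uniq_p h1 h2 hr h
  | succ j ih =>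
    obtain ⟨a, ha⟩ := force1 h1 h (v_force h1 h2 hr j) (y := v β j)
      (by rw [v_succ h1]; ring)
    rw [← cs_eta ε, a, ih ha]
    rfl

/-- The expansions of `x_{m+1}`. -/
lemma main_zero (h1 : 1 < β) (h2 : β < 2) (hr : β ^ 4 - β ^ 3 - β ^ 2 - β - 1 = 0) : {ε | isExpansion β (v β 3 / β) ε} = {cs 0 (w 3)} := by
  have h0 : β ≠ 0 := by positivity
  have e : v β 3 = β * (v β 3 / β) := by field_simp
  ext ε
  simp only [Set.mem_ofPred_eq, Set.mem_singleton_iff]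
  constructor
  · intro h
    obtain ⟨a, ha⟩ := force0 h1 h (by rw [← e]; exact v3_lt h1 h2 hr) e
    rw [← cs_eta ε, a, uniq_w h1 h2 hr 3 ha]
  · rintro rfl
    exact exp_cs h1 (by norm_num) (by rw [← e]; simp) (exp_w h1 3)

lemma main_succ (h1 : 1 < β) (h2 : β < 2) (hr : β ^ 4 - β ^ 3 - β ^ 2 - β - 1 = 0) (n : ℕ) : {ε | isExpansion β (v β (n + 4) / β) ε} =
    insert (cs 0 (w (n + 4)))
      ((fun ε => cs 1 (cs 0 (cs 0 (cs 0 ε)))) '' {ε | isExpansion β (v β n / β) ε}) := by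
  have h0 : β ≠ 0 := by positivity
  have hp : 0 < β := by positivity
  have e : v β (n + 4) = β * (v β (n + 4) / β) := by field_simp
  have f := v4 h1 hr n
  have f' : v β (n + 4) - 1 = v β n / β ^ 4 := by
    rw [eq_div_iff (by positivity)]; linarith
  have hv := v_lt_beta h1 h2 hr n
  have e3 : v β n / β ^ 3 = β * (v β n / β ^ 4) := by field_simp
  have e2 : v β n / β ^ 2 = β * (v β n / β ^ 3) := by field_simp
  have e1 : v β n / β = β * (v β n / β ^ 2) := by field_simp
  have l1 : v β n / β < 1 := by rw [div_lt_one hp]; exact hv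
  have hpos : 0 < v β n := lt_of_lt_of_le (v0_pos h1) (v_ge h1 h2 hr n)
  have p2 : 0 < v β n / β ^ 2 := by positivity
  have p3 : 0 < v β n / β ^ 3 := by positivity
  have l2 : v β n / β ^ 2 < 1 := by nlinarith
  have l3 : v β n / β ^ 3 < 1 := by nlinarith
  ext ε
  simp only [Set.mem_ofPred_eq, Set.mem_insert_iff, Set.mem_image]
  constructor
  · intro h
    obtain ⟨hd, h'⟩ := (exp_step h1).1 h
    rw [← e] at h'
    have : ε 0 = 0 ∨ ε 0 = 1 := by omega
    rcases this with hz | hz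
    · left
      rw [hz] at h'
      simp only [Nat.cast_zero, sub_zero] at h'
      rw [← cs_eta ε, hz, uniq_w h1 h2 hr _ h']
    · right
      rw [hz, Nat.cast_one, f'] at h'
      obtain ⟨a, ha⟩ := force0 h1 h' (by rw [← e3]; exact l3) e3
      obtain ⟨b, hb⟩ := force0 h1 ha (by rw [← e2]; exact l2) e2
      obtain ⟨c, hc⟩ := force0 h1 hb (by rw [← e1]; exact l1) e1
      refine ⟨_, hc, ?_⟩
      funext i
      match i with
      | 0 => exact hz.symm
      | 1 => exact a.symm
      | 2 => exact b.symm
      | 3 => exact c.symm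
      | i + 4 => rfl
  · rintro (rfl | ⟨δ, hδ, rfl⟩)
    · exact exp_cs h1 (by norm_num) (by rw [← e]; simp) (exp_w h1 _)
    · refine exp_cs h1 le_rfl (y := v β n / β ^ 4) (by rw [← e, ← f']; simp) ?_
      refine exp_cs h1 zero_le_one (y := v β n / β ^ 3) (by rw [← e3]; simp) ?_
      refine exp_cs h1 zero_le_one (y := v β n / β ^ 2) (by rw [← e2]; simp) ?_
      exact exp_cs h1 zero_le_one (by rw [← e1]; simp) hδ

lemma main (h1 : 1 < β) (h2 : β < 2) (hr : β ^ 4 - β ^ 3 - β ^ 2 - β - 1 = 0) (m : ℕ) : {ε | isExpansion β (v β (4 * m + 3) / β) ε}.Finite ∧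
    {ε | isExpansion β (v β (4 * m + 3) / β) ε}.ncard = m + 1 ∧
    ∀ ε, isExpansion β (v β (4 * m + 3) / β) ε → endsIn011 ε := by
  induction m with
  | zero =>
    have h := main_zero h1 h2 hr
    simp only [mul_zero, zero_add]
    rw [h]
    refine ⟨Set.finite_singleton _, Set.ncard_singleton _, fun ε hε => ?_⟩
    have : ε ∈ {ε | isExpansion β (v β 3 / β) ε} := hε
    rw [h] at this
    rw [Set.mem_singleton_iff.1 this]
    exact ends_cs (ends_w _)
  | succ m ih =>
    obtain ⟨i1, i2, i3⟩ := ih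
    have h := main_succ h1 h2 hr (4 * m + 3)
    rw [show 4 * (m + 1) + 3 = 4 * m + 3 + 4 by ring, h]
    refine ⟨(i1.image _).insert _, ?_, fun ε hε => ?_⟩
    · rw [Set.ncard_insert_of_notMem _ (i1.image _), Set.ncard_image_of_injective, i2]
      · intro x y hxy
        exact cs_inj (cs_inj (cs_inj (cs_inj hxy)))
      · rintro ⟨δ, -, hδ⟩
        have := congrFun hδ 0
        simp [cs] at this
    · have : ε ∈ {ε | isExpansion β (v β (4 * m + 3 + 4) / β) ε} := hε
      rw [h] at this
      rcases this with rfl | ⟨δ, hδ, rfl⟩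
      · exact ends_cs (ends_w _)
      · exact ends_cs (ends_cs (ends_cs (ends_cs (i3 δ hδ))))

lemma seq_val (h1 : 1 < β) (m : ℕ) : ∑' i : ℕ, (multinacciSeq (m + 1) i : ℝ) / β ^ (i + 1)
    = v β (4 * m + 3) / β := by
  have h0 : β ≠ 0 := by positivity
  have h : isExpansion β (v β (4 * m + 3) / β) (cs 0 (w (4 * m + 3))) :=
    exp_cs h1 (by norm_num) (by field_simp; simp) (exp_w h1 _)
  rw [seq_eq]
  exact h.2.symm

end
end MN

theorem multinacci_exactly_k_expansions_none_simply_normal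
    (β : ℝ) (hβ : β ∈ Set.Ioo (1 : ℝ) 2)
    (hroot : β ^ 4 - β ^ 3 - β ^ 2 - β - 1 = 0)
    (k : ℕ) (hk : 1 ≤ k) :
    {ε : ℕ → ℕ |
        isExpansion β (∑' i : ℕ, (multinacciSeq k i : ℝ) / β ^ (i + 1)) ε}.ncard
      = k ∧
    ∀ ε : ℕ → ℕ,
      isExpansion β (∑' i : ℕ, (multinacciSeq k i : ℝ) / β ^ (i + 1)) ε →
      endsIn011 ε ∧ ¬ simplyNormal ε := by
  obtain ⟨h1, h2⟩ := hβ
  obtain ⟨m, rfl⟩ : ∃ m, k = m + 1 := ⟨k - 1, by omega⟩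
  rw [MN.seq_val h1]
  obtain ⟨-, a, b⟩ := MN.main h1 h2 hroot m
  exact ⟨a, fun ε hε => ⟨b ε hε, MN.not_sn (b ε hε)⟩⟩
end
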